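/- There exists a self-dual binary linear code C ⊆ F₂^{72} whose minimum nonzero Hamming weight is 12, which contains exactly 1242 codewords of Hamming weight 12 and exactly 8640 codewords of Hamming weight 14 (the weight enumerator W_{72,1} with γ = 0 and β = 621). -/

import Mathlib

/-- A subspace `C` of `(ZMod 2)^ι` is self-dual if it equals its Euclidean dual. -/
def IsSelfDual {R : Type*} [CommRing R] {ι : Type*} [Fintype ι]
    (C : Submodule R (ι → R)) : Prop :=
  ∀ x, x ∈ C ↔ ∀ y ∈ C, ∑ i, x i * y i = 0

/-- The Hamming weight of a vector: the number of nonzero coordinates. -/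
def hamWt {ι : Type*} [Fintype ι] {R : Type*} [Zero R] [DecidableEq R] (v : ι → R) : ℕ :=
  (Finset.univ.filter fun i => v i ≠ 0).card

/-- Apply `k` to `n`, making the kernel reduce `n` to a literal first. -/
def force {α : Type} (n : ℕ) (k : ℕ → α) : α :=
  Nat.casesOn n (k 0) fun m => k (Nat.succ m)

/-- Apply `k` to a list, reducing its entries to literals first. -/
def forceList {α : Type} : List ℕ → (List ℕ → α) → α
  | [], k => k []
  | x :: xs, k => force x fun y => forceList xs fun ys => k (y :: ys)

/-- Apply `k` to a list of lists, reducing all entries to literals first. -/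
def forceTable {α : Type} : List (List ℕ) → (List (List ℕ) → α) → α
  | [], k => k []
  | x :: xs, k => forceList x fun y => forceTable xs fun ys => k (y :: ys)

/-- The columns of the concatenation of a list of length `len` with columns `as` and of the
`r`-translate of a list with columns `bs`, where `ones` is the column of ones of the latter. -/
def mergeColumns (len ones : ℕ) : ℕ → List ℕ → List ℕ → List ℕ
  | r, a :: as, b :: bs =>
    (a + Nat.shiftLeft (cond (Nat.beq (r % 2) 1) (ones - b) b) len) ::
      mergeColumns len ones (r / 2) as bs
  | _, _, _ => []

/-- `mergeColumns` for blocks, which are columns preceded by their length. -/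
def mergeBlock (r : ℕ) : List ℕ → List ℕ → List ℕ
  | la :: as, lb :: bs => (la + lb) :: mergeColumns la (2 ^ lb - 1) r as bs
  | _, _ => []

/-- Merge every block of a table with the translate of its predecessor. -/
def mergeTable (r : ℕ) : List ℕ → List (List ℕ) → List (List ℕ)
  | x, y :: t => mergeBlock r y x :: mergeTable r y t
  | _, [] => []

/-- Extend a table of blocks of subset sums by further summands. -/
def buildTable {α : Type} : List ℕ → List (List ℕ) → (List (List ℕ) → α) → α
  | [], t, k => k t
  | _ :: rs, [], k => buildTable rs [] k
  | r :: rs, b :: t, k => forceTable (b :: mergeTable r b t) fun next => buildTable rs next k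

/-- Bitwise addition of columns by full adders, with the sums and the list of carries passed on. -/
def addColumns {α : Type} : ℕ → List ℕ → (ℕ → List ℕ → α) → α
  | s, [], k => k s []
  | s, [x], k => force (s ^^^ x) fun t => force (s &&& x) fun c => k t [c]
  | s, x :: y :: xs, k =>
    force (s ^^^ x) fun t => force ((s &&& x) ||| (t &&& y)) fun c => force (t ^^^ y) fun u =>
      addColumns u xs fun v cs => k v (c :: cs)

/-- The positions in the mask `m` at which exactly `j` of the given columns have a one. -/
def matchMask : ℕ → List ℕ → ℕ → ℕ → ℕ
  | f + 1, x :: xs, j, m =>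
    addColumns x xs fun s cs =>
      force (cond (Nat.beq (j % 2) 1) (m &&& s) (m ^^^ (m &&& s))) fun next =>
        matchMask f cs (j / 2) next
  | _, _, j, m => cond (Nat.beq j 0) m 0

/-- The number of binary ones of `x`, up to a bound, by clearing the lowest one repeatedly. -/
def clearCount : ℕ → ℕ → ℕ
  | 0, _ => 0
  | f + 1, x => cond (Nat.beq x 0) 0 (force (x &&& (x - 1)) fun y => 1 + clearCount f y)

/-- The number of binary ones of a number with at most `2 ^ (f + 16)` digits, by bisection. -/
def bisectCount : ℕ → ℕ → ℕ
  | 0, x => clearCount 65536 x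
  | f + 1, x =>
    cond (Nat.beq x 0) 0
      (force (x % 2 ^ 2 ^ (f + 16)) fun lo => force (Nat.shiftRight x (2 ^ (f + 16))) fun hi =>
        bisectCount f lo + bisectCount f hi)

/-- The number of entries of a block that have exactly `j` ones. -/
def countBlock (j : ℕ) : List ℕ → ℕ
  | [] => 0
  | len :: cols => force (matchMask 7 cols j (2 ^ len - 1)) (bisectCount 7)

/-- `k` empty blocks with `n` columns. -/
def emptyTable (n : ℕ) : ℕ → List (List ℕ)
  | 0 => []
  | k + 1 => (0 :: List.replicate n 0) :: emptyTable n k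

/-- Check, for each entry `(k, j, c)` of `T`, that exactly `c` of the sums of `k` of the given rows
of length `n` have weight `j`. -/
def checkCounts (rows : List ℕ) (n K : ℕ) (T : List (ℕ × ℕ × ℕ)) : Bool :=
  buildTable rows ((1 :: List.replicate n 0) :: emptyTable n K) fun t =>
    T.all fun e => Nat.beq (countBlock e.2.1 (t.getD e.1 [])) e.2.2

theorem natBeq_eq_decide (a b : ℕ) : Nat.beq a b = decide (a = b) := by
  rw [Bool.eq_iff_iff, Nat.beq_eq, decide_eq_true_iff]

@[simp]
theorem force_eq {α : Type} (n : ℕ) (k : ℕ → α) : force n k = k n := by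
  cases n <;> rfl

@[simp]
theorem forceList_eq {α : Type} (l : List ℕ) (k : List ℕ → α) : forceList l k = k l := by
  induction l generalizing k with
  | nil => rfl
  | cons x xs ih => simp [forceList, ih]

@[simp]
theorem forceTable_eq {α : Type} (t : List (List ℕ)) (k : List (List ℕ) → α) :
    forceTable t k = k t := by
  induction t generalizing k with
  | nil => rfl
  | cons x xs ih => simp [forceTable, ih]

/-- The number whose binary digits, from the lowest one on, are given by a list. -/
def ofBits : List Bool → ℕ
  | [] => 0
  | b :: bs => b.toNat + 2 * ofBits bs

theorem ofBits_lt (bs : List Bool) : ofBits bs < 2 ^ bs.length := by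
  induction bs with
  | nil => simp [ofBits]
  | cons b bs ih => cases b <;> simp [ofBits, pow_succ] <;> lia

theorem ofBits_append (as bs : List Bool) :
    ofBits (as ++ bs) = ofBits as + 2 ^ as.length * ofBits bs := by
  induction as with
  | nil => simp [ofBits]
  | cons a as ih => simp only [List.cons_append, ofBits, ih, List.length_cons, pow_succ]; ring

theorem ofBits_map_not (bs : List Bool) :
    ofBits (bs.map not) = 2 ^ bs.length - 1 - ofBits bs := by
  induction bs with
  | nil => simp [ofBits]
  | cons b bs ih =>
    have := ofBits_lt bs
    cases b <;> simp [ofBits, ih, pow_succ] <;> lia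

theorem testBit_ofBits (bs : List Bool) (i : ℕ) : (ofBits bs).testBit i = bs.getD i false := by
  induction bs generalizing i with
  | nil => simp [ofBits]
  | cons b bs ih =>
    cases i with
    | zero => cases b <;> simp [ofBits, Nat.testBit_zero]
    | succ i =>
      rw [Nat.testBit_succ, List.getD_cons_succ, ← ih]
      congr 1
      cases b <;> (simp [ofBits]; try lia)

theorem length_bitIndices_ofBits (bs : List Bool) :
    (ofBits bs).bitIndices.length = bs.countP id := by
  induction bs with
  | nil => simp [ofBits]
  | cons b bs ih => cases b <;> simp [ofBits, add_comm 1, ih]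

theorem length_bitIndices_and_pred {x : ℕ} (hx : x ≠ 0) :
    (x &&& (x - 1)).bitIndices.length + 1 = x.bitIndices.length := by
  induction x using Nat.strong_induction_on with
  | _ x ih =>
    obtain ⟨y, rfl | rfl⟩ := x.even_or_odd'
    · have hy : 2 * y &&& (2 * y - 1) = 2 * (y &&& (y - 1)) := by
        refine Nat.eq_of_testBit_eq fun i => ?_
        cases i with
        | zero => simp [Nat.testBit_zero]
        | succ i =>
          rw [Nat.testBit_and, Nat.testBit_succ, Nat.testBit_succ, Nat.testBit_succ]
          rw [show (2 * y - 1) / 2 = y - 1 by lia, show 2 * y / 2 = y by lia,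
            show 2 * (y &&& (y - 1)) / 2 = y &&& (y - 1) by lia, Nat.testBit_and]
      rw [hy]
      simp [ih y (by lia) (by lia)]
    · have hy : (2 * y + 1) &&& (2 * y + 1 - 1) = 2 * y := by
        refine Nat.eq_of_testBit_eq fun i => ?_
        cases i with
        | zero => simp [Nat.testBit_zero]
        | succ i =>
          rw [Nat.testBit_and, Nat.testBit_succ, Nat.testBit_succ]
          rw [show (2 * y + 1 - 1) / 2 = y by lia, show (2 * y + 1) / 2 = y by lia,
            Bool.and_self, Nat.testBit_succ, show 2 * y / 2 = y by lia]
      rw [hy]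
      simp

theorem clearCount_eq {f x : ℕ} (h : x.bitIndices.length ≤ f) :
    clearCount f x = x.bitIndices.length := by
  induction f generalizing x with
  | zero => simp [clearCount] at h ⊢; simp [h]
  | succ f ih =>
    rcases eq_or_ne x 0 with rfl | hx
    · simp [clearCount]
    · have := length_bitIndices_and_pred hx
      have hb : Nat.beq x 0 = false := by simpa [natBeq_eq_decide] using hx
      simp only [clearCount, hb, cond_false, force_eq]
      rw [ih (by lia)]
      lia

theorem length_bitIndices_mod_add_div (n x : ℕ) :
    (x % 2 ^ n).bitIndices.length + (x / 2 ^ n).bitIndices.length = x.bitIndices.length := by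
  induction n generalizing x with
  | zero => simp [Nat.mod_one]
  | succ n ih =>
    rw [pow_succ', ← Nat.div_div_eq_div_mul, Nat.mod_mul]
    have h := ih (x / 2)
    rcases Nat.mod_two_eq_zero_or_one x with hx | hx
    · have e : x = 2 * (x / 2) := by lia
      rw [hx, zero_add, Nat.bitIndices_two_mul, List.length_map, h]
      conv_rhs => rw [e]
      simp
    · have e : x = 2 * (x / 2) + 1 := by lia
      rw [hx, add_comm 1, Nat.bitIndices_two_mul_add_one, List.length_cons, List.length_map,
        add_right_comm, h]
      conv_rhs => rw [e]
      simp

theorem length_bitIndices_le {n x : ℕ} (h : x < 2 ^ n) : x.bitIndices.length ≤ n := by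
  have hsub : x.bitIndices.toFinset ⊆ Finset.range n := fun i hi => by
    rw [List.mem_toFinset] at hi
    exact Finset.mem_range.2 ((Nat.pow_lt_pow_iff_right (by norm_num)).1
      ((Nat.two_pow_le_of_mem_bitIndices hi).trans_lt h))
  simpa [List.toFinset_card_of_nodup Nat.bitIndices_nodup] using Finset.card_le_card hsub

theorem bisectCount_eq {f x : ℕ} (h : x < 2 ^ 2 ^ (f + 16)) :
    bisectCount f x = x.bitIndices.length := by
  induction f generalizing x with
  | zero => exact clearCount_eq ((length_bitIndices_le h).trans (by norm_num))
  | succ f ih =>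
    rcases eq_or_ne x 0 with rfl | hx
    · rw [Nat.bitIndices_zero]
      rfl
    · have hb : Nat.beq x 0 = false := by simpa [natBeq_eq_decide] using hx
      have hs : Nat.shiftRight x (2 ^ (f + 16)) = x / 2 ^ 2 ^ (f + 16) :=
        Nat.shiftRight_eq_div_pow _ _
      simp only [bisectCount, hb, cond_false, force_eq]
      rw [ih (Nat.mod_lt _ (by positivity)), hs, ih, length_bitIndices_mod_add_div]
      rw [Nat.div_lt_iff_lt_mul (by positivity), ← pow_add, ← two_mul, ← pow_succ']
      convert h using 3

/-- The number of ones among the `n` lowest binary digits of `x`. -/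
def lowWeight : ℕ → ℕ → ℕ
  | 0, _ => 0
  | n + 1, x => x % 2 + lowWeight n (x / 2)

/-- The bit columns of a list of `n`-digit binary numbers. -/
def columns : ℕ → List ℕ → List ℕ
  | 0, _ => []
  | n + 1, L => ofBits (L.map fun x => Nat.beq (x % 2) 1) :: columns n (L.map (· / 2))

/-- The number of ones at position `i` in a list of columns. -/
def bitSum (i : ℕ) (cs : List ℕ) : ℕ := (cs.map fun c => (c.testBit i).toNat).sum

theorem bitSum_columns (n : ℕ) (L : List ℕ) {i : ℕ} (hi : i < L.length) :
    bitSum i (columns n L) = lowWeight n L[i] := by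
  induction n generalizing L with
  | zero => rfl
  | succ n ih =>
    have := ih (L.map (· / 2)) (by simpa using hi)
    simp only [bitSum, columns, List.map_cons, List.sum_cons, lowWeight] at this ⊢
    rw [this, testBit_ofBits]
    rcases Nat.mod_two_eq_zero_or_one L[i] with h | h <;> simp [hi, h, natBeq_eq_decide]

theorem length_columns (n : ℕ) (L : List ℕ) : (columns n L).length = n := by
  induction n generalizing L with
  | zero => rfl
  | succ n ih => simp [columns, ih]

theorem columns_append_map_xor (n r : ℕ) (A B : List ℕ) :
    columns n (A ++ B.map (r ^^^ ·)) =
      mergeColumns A.length (2 ^ B.length - 1) r (columns n A) (columns n B) := by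
  induction n generalizing r A B with
  | zero => rfl
  | succ n ih =>
    simp only [columns, mergeColumns]
    congr 1
    · have hs (b len : ℕ) : Nat.shiftLeft b len = 2 ^ len * b := by
        rw [Nat.shiftLeft_eq', Nat.shiftLeft_eq, mul_comm]
      rw [List.map_append, ofBits_append, List.length_map, List.map_map, hs]
      congr 2
      rcases Nat.mod_two_eq_zero_or_one r with h | h
      · simp only [h, natBeq_eq_decide, zero_ne_one, decide_false, cond_false]
        congr 1
        refine List.map_congr_left fun x _ => ?_
        have : (r ^^^ x) % 2 = x % 2 := by
          have := @Nat.xor_mod_two_eq_one r x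
          lia
        simp [this]
      · rw [h]
        have : (2 : ℕ) ^ B.length = 2 ^ (B.map fun x => Nat.beq (x % 2) 1).length := by simp
        simp only [natBeq_eq_decide, decide_true, cond_true] at this ⊢
        rw [this, ← ofBits_map_not, List.map_map]
        congr 1
        refine List.map_congr_left fun x _ => ?_
        have := @Nat.xor_mod_two_eq_one r x
        simp only [Function.comp_apply]
        rcases Nat.mod_two_eq_zero_or_one x with hx | hx <;>
          rcases Nat.mod_two_eq_zero_or_one (r ^^^ x) with hr | hr <;>
          simp [hx, hr] <;> lia
    · have := ih (r / 2) (A.map (· / 2)) (B.map (· / 2))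
      rw [List.length_map, List.length_map] at this
      rw [← this, List.map_append, List.map_map, List.map_map]
      congr 2
      refine List.map_congr_left fun x _ => ?_
      simp [Nat.xor_div_two]

/-- The block of a list of `n`-digit binary numbers. -/
def block (n : ℕ) (L : List ℕ) : List ℕ := L.length :: columns n L

theorem mergeBlock_block (n r : ℕ) (A B : List ℕ) :
    mergeBlock r (block n A) (block n B) = block n (A ++ B.map (r ^^^ ·)) := by
  simp [mergeBlock, block, columns_append_map_xor]

theorem bitSum_addColumns (s : ℕ) (xs : List ℕ) :
    ∃ (v : ℕ) (cs : List ℕ), (∀ k : ℕ → List ℕ → ℕ, addColumns s xs k = k v cs) ∧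
      cs.length = (xs.length + 1) / 2 ∧
      ∀ i, bitSum i (s :: xs) = (v.testBit i).toNat + 2 * bitSum i cs := by
  induction xs using List.twoStepInduction generalizing s with
  | nil => exact ⟨s, [], fun k => by simp [addColumns], rfl, fun i => by simp [bitSum]⟩
  | singleton x =>
    refine ⟨s ^^^ x, [s &&& x], fun k => by simp [addColumns], by simp, fun i => ?_⟩
    cases hs : s.testBit i <;> cases hx : x.testBit i <;> simp [bitSum, hs, hx]
  | cons_cons x y xs ih =>
    obtain ⟨v, cs, h, hl, hb⟩ := ih (s ^^^ x ^^^ y)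
    refine ⟨v, ((s &&& x) ||| ((s ^^^ x) &&& y)) :: cs, fun k => by simp [addColumns, h], ?_,
      fun i => ?_⟩
    · simp only [List.length_cons, hl]
      lia
    · have := hb i
      simp only [bitSum, List.map_cons, List.sum_cons, Nat.testBit_xor, Nat.testBit_and,
        Nat.testBit_or] at this ⊢
      cases hs : s.testBit i <;> cases hx : x.testBit i <;> cases hy : y.testBit i <;>
        simp [hs, hx, hy] at this ⊢ <;> lia

theorem testBit_matchMask {f : ℕ} {xs : List ℕ} (h : xs.length < 2 ^ f) (j m i : ℕ) :
    (matchMask f xs j m).testBit i = (m.testBit i && decide (bitSum i xs = j)) := by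
  induction f generalizing xs j m with
  | zero =>
    obtain rfl : xs = [] := by simpa using h
    cases j <;> simp [matchMask, bitSum, natBeq_eq_decide]
  | succ f ih =>
    cases xs with
    | nil => cases j <;> simp [matchMask, bitSum, natBeq_eq_decide]
    | cons x xs =>
      obtain ⟨v, cs, hk, hl, hb⟩ := bitSum_addColumns x xs
      have hcs : cs.length < 2 ^ f := by
        rw [List.length_cons, pow_succ] at h
        lia
      simp only [matchMask, hk, force_eq]
      rw [ih hcs, hb]
      have hj := Nat.div_add_mod j 2
      rcases Nat.mod_two_eq_zero_or_one j with h2 | h2 <;>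
        cases hm : m.testBit i <;> cases hv : v.testBit i <;>
        simp [h2, hm, hv, natBeq_eq_decide] <;> lia

theorem countBlock_block {n : ℕ} (hn : n < 2 ^ 7) {L : List ℕ} (hL : L.length ≤ 2 ^ 23) (j : ℕ) :
    countBlock j (block n L) = L.countP fun x => lowWeight n x = j := by
  have hm : matchMask 7 (columns n L) j (2 ^ L.length - 1) =
      ofBits (L.map fun x => decide (lowWeight n x = j)) := by
    refine Nat.eq_of_testBit_eq fun i => ?_
    rw [testBit_matchMask (by rwa [length_columns]), testBit_ofBits, Nat.testBit_two_pow_sub_one]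
    by_cases hi : i < L.length
    · simp [bitSum_columns n L hi, hi]
    · simp [hi]
  have hlt := ofBits_lt (L.map fun x => decide (lowWeight n x = j))
  rw [List.length_map] at hlt
  simp only [countBlock, block, force_eq]
  rw [hm, bisectCount_eq (hlt.trans_le (Nat.pow_le_pow_right (by norm_num) hL)),
    length_bitIndices_ofBits, List.countP_map]
  rfl

/-- The sums, in the sense of bitwise addition, of the sublists of length `k` of a list. -/
def sublistXors (l : List ℕ) (k : ℕ) : List ℕ :=
  (l.sublistsLen k).map (List.foldr (· ^^^ ·) 0)

theorem sublistXors_cons (r : ℕ) (l : List ℕ) (k : ℕ) :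
    sublistXors (r :: l) (k + 1) = sublistXors l (k + 1) ++ (sublistXors l k).map (r ^^^ ·) := by
  simp [sublistXors, List.sublistsLen_succ_cons, Function.comp_def]

theorem mergeTable_range' (n r : ℕ) (l : List ℕ) (m k : ℕ) :
    mergeTable r (block n (sublistXors l k))
        ((List.range' (k + 1) m).map fun i => block n (sublistXors l i)) =
      (List.range' (k + 1) m).map fun i => block n (sublistXors (r :: l) i) := by
  induction m generalizing k with
  | zero => rfl
  | succ m ih =>
    simp only [List.range'_succ, List.map_cons, mergeTable, ih, mergeBlock_block, sublistXors_cons]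

theorem buildTable_range {α : Type} (n K : ℕ) (rows l : List ℕ) (k : List (List ℕ) → α) :
    buildTable rows ((List.range (K + 1)).map fun i => block n (sublistXors l i)) k =
      k ((List.range (K + 1)).map fun i => block n (sublistXors (rows.reverse ++ l) i)) := by
  induction rows generalizing l with
  | nil => simp [buildTable]
  | cons r rows ih =>
    have h0 : block n (sublistXors (r :: l) 0) = block n (sublistXors l 0) := by
      simp [sublistXors]
    have := ih (r :: l)
    simp only [List.range_eq_range', List.range'_succ, List.map_cons, zero_add, buildTable,
      forceTable_eq, List.reverse_cons, List.append_assoc, List.cons_append, List.nil_append,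
      h0] at this ⊢
    rw [← this, ← mergeTable_range']

theorem columns_zero_cases (n : ℕ) :
    columns n [0] = List.replicate n 0 ∧ columns n [] = List.replicate n 0 := by
  induction n with
  | zero => exact ⟨rfl, rfl⟩
  | succ n ih => simp [columns, ih, List.replicate_succ, ofBits, natBeq_eq_decide]

theorem emptyTable_eq (n K : ℕ) :
    (1 :: List.replicate n 0) :: emptyTable n K =
      (List.range (K + 1)).map fun i => block n (sublistXors [] i) := by
  obtain ⟨h0, h1⟩ := columns_zero_cases n
  have he (k : ℕ) : ∀ K, emptyTable n K =
      (List.range' (k + 1) K).map fun i => block n (sublistXors [] i) := by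
    intro K
    induction K generalizing k with
    | zero => rfl
    | succ K ih => simp [emptyTable, List.range'_succ, ih (k + 1), block, sublistXors, h1]
  rw [he 0 K, List.range_eq_range', List.range'_succ]
  simp [block, sublistXors, h0]

theorem countP_of_checkCounts {rows : List ℕ} {n K : ℕ} {T : List (ℕ × ℕ × ℕ)}
    (h : checkCounts rows n K T = true) (hn : n < 2 ^ 7) {k j c : ℕ} (he : (k, j, c) ∈ T)
    (hk : k ≤ K) (hlen : rows.length.choose k ≤ 2 ^ 23) :
    (sublistXors rows.reverse k).countP (fun x => lowWeight n x = j) = c := by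
  rw [checkCounts, emptyTable_eq, buildTable_range, List.append_nil, List.all_eq_true] at h
  have := Nat.eq_of_beq_eq_true (h _ he)
  dsimp only at this
  rw [← this, ← countBlock_block hn (by simpa [sublistXors] using hlen)]
  simp [List.getD_eq_getElem?_getD, Nat.lt_succ_of_le hk]

/-- The vector of the `n` lowest binary digits of `x`. -/
def bitVec (n x : ℕ) : Fin n → ZMod 2 := fun j => if x.testBit j then 1 else 0

theorem bitVec_xor (n a b : ℕ) : bitVec n (a ^^^ b) = bitVec n a + bitVec n b := by
  ext j
  cases ha : a.testBit j <;> cases hb : b.testBit j <;>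
    simp [bitVec, ha, hb, CharTwo.add_self_eq_zero]

theorem bitVec_foldr_xor (n : ℕ) (l : List ℕ) :
    bitVec n (l.foldr (· ^^^ ·) 0) = (l.map (bitVec n)).sum := by
  induction l with
  | nil => ext j; simp [bitVec]
  | cons x l ih => simp [bitVec_xor, ih]

theorem hamWt_bitVec (n x : ℕ) : hamWt (bitVec n x) = lowWeight n x := by
  induction n generalizing x with
  | zero => simp [hamWt, lowWeight]
  | succ n ih =>
    have h := ih (x / 2)
    simp only [hamWt, Finset.card_filter, Fin.sum_univ_succ, lowWeight] at h ⊢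
    rw [← h]
    congr 1
    · rcases Nat.mod_two_eq_zero_or_one x with hx | hx <;> simp [bitVec, Nat.testBit_zero, hx]
    · simp [bitVec, Nat.testBit_succ]

/-- The number of vectors of weight `a` that `M` maps to a vector of weight `b`. -/
def weightCount {m n : ℕ} (M : Matrix (Fin m) (Fin n) (ZMod 2)) (a b : ℕ) : ℕ :=
  (Finset.univ.filter fun u => hamWt u = a ∧ hamWt (Matrix.vecMul u M) = b).card

theorem weightCount_ne_zero {m n : ℕ} (M : Matrix (Fin m) (Fin n) (ZMod 2)) (u : Fin m → ZMod 2) :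
    weightCount M (hamWt u) (hamWt (Matrix.vecMul u M)) ≠ 0 :=
  Finset.card_ne_zero_of_mem (Finset.mem_filter.2 ⟨Finset.mem_univ u, rfl, rfl⟩)

theorem card_filter_powersetCard {m n : ℕ} (M : Matrix (Fin m) (Fin n) (ZMod 2)) (k j : ℕ) :
    ((Finset.powersetCard k Finset.univ).filter fun S => hamWt (∑ i ∈ S, M.row i) = j).card =
      weightCount M k j := by
  have hsum (S : Finset (Fin m)) :
      Matrix.vecMul (fun i => if i ∈ S then (1 : ZMod 2) else 0) M = ∑ i ∈ S, M.row i := by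
    ext j
    simp [Matrix.vecMul, dotProduct, Finset.sum_apply]
  refine Finset.card_nbij' (fun S i => if i ∈ S then 1 else 0)
    (fun u => Finset.univ.filter fun i => u i ≠ 0) ?_ ?_ ?_ ?_
  · intro S hS
    simp only [Finset.coe_filter, Finset.mem_powersetCard_univ, Set.mem_ofPred_eq] at hS
    simp only [Finset.coe_filter, Finset.mem_univ, true_and, Set.mem_ofPred_eq, hsum]
    exact ⟨by simpa [hamWt] using hS.1, hS.2⟩
  · intro u hu
    simp only [Finset.coe_filter, Finset.mem_univ, true_and, Set.mem_ofPred_eq] at hu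
    have : u = fun i => if i ∈ Finset.univ.filter (fun i => u i ≠ 0) then (1 : ZMod 2) else 0 := by
      ext i
      have : u i = 0 ∨ u i = 1 := by generalize u i = a; revert a; decide
      rcases this with h | h <;> simp [h]
    simp only [Finset.coe_filter, Finset.mem_powersetCard_univ, Set.mem_ofPred_eq]
    exact ⟨hu.1, by rw [← hsum, ← this]; exact hu.2⟩
  · intro S _
    ext i
    simp
  · intro u _
    ext i
    have : u i = 0 ∨ u i = 1 := by generalize u i = a; revert a; decide
    rcases this with h | h <;> simp [h]

/-- The matrix whose rows are the `n` lowest binary digits of given numbers. -/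
def bitMatrix (m n : ℕ) (rows : List ℕ) : Matrix (Fin m) (Fin n) (ZMod 2) :=
  Matrix.of fun i => bitVec n (rows.getD i 0)

theorem countP_sublistXors (n : ℕ) (rows : List ℕ) (k j : ℕ) :
    (sublistXors rows.reverse k).countP (fun x => lowWeight n x = j) =
      weightCount (bitMatrix rows.length n rows) k j := by
  have hrows : (rows.reverse : Multiset ℕ) =
      Multiset.map (fun i : Fin rows.length => rows.getD i 0) Finset.univ.val := by
    have : (fun i : Fin rows.length => rows.getD i 0) = rows.get := by ext i; simp
    rw [this, Fin.univ_val_map, List.ofFn_get, Multiset.coe_reverse]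
  rw [← card_filter_powersetCard]
  calc (sublistXors rows.reverse k).countP (fun x => lowWeight n x = j)
      = Multiset.countP (fun s => hamWt (s.map (bitVec n)).sum = j)
          (Multiset.powersetCard k (rows.reverse : Multiset ℕ)) := by
        rw [Multiset.powersetCard_coe, Multiset.coe_countP, sublistXors, List.countP_map,
          List.countP_map]
        simp only [Function.comp_def, Multiset.map_coe, Multiset.sum_coe, ← bitVec_foldr_xor,
          hamWt_bitVec]
    _ = _ := by
        rw [hrows, Multiset.powersetCard_map, ← Finset.map_val_val_powersetCard,
          Multiset.map_map, Multiset.countP_map]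
        simp only [Function.comp_def, Multiset.map_map]
        rfl

theorem weightCount_of_checkCounts {rows : List ℕ} {m n K : ℕ} {T : List (ℕ × ℕ × ℕ)}
    (h : checkCounts rows n K T = true) (hm : rows.length = m) (hn : n < 2 ^ 7) {k j c : ℕ}
    (he : (k, j, c) ∈ T) (hk : k ≤ K) (hlen : m.choose k ≤ 2 ^ 23) :
    weightCount (bitMatrix m n rows) k j = c := by
  subst hm
  rw [← countP_sublistXors, countP_of_checkCounts h hn he hk hlen]

theorem weightCount_transpose {n : ℕ} {M : Matrix (Fin n) (Fin n) (ZMod 2)}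
    (hM : M * M.transpose = 1) (a b : ℕ) : weightCount M.transpose a b = weightCount M b a := by
  have hM' := mul_eq_one_comm.1 hM
  refine Finset.card_nbij' (fun u => Matrix.vecMul u M.transpose) (fun u => Matrix.vecMul u M)
    ?_ ?_ ?_ ?_ <;> intro u hu
  · simpa [hM', and_comm] using hu
  · simpa [hM, and_comm] using hu
  · simp [hM']
  · simp [hM]

section SystematicCode

variable {n : ℕ} (M : Matrix (Fin n) (Fin n) (ZMod 2))

/-- The code with generator matrix `[I | M]`. -/
def systematicCode : Submodule (ZMod 2) (Fin (n + n) → ZMod 2) where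
  carrier := {v | (fun i => v (Fin.natAdd n i)) = Matrix.vecMul (fun i => v (Fin.castAdd n i)) M}
  add_mem' {a b} ha hb := by
    simp only [Set.mem_ofPred_eq] at ha hb ⊢
    change (fun i => a (Fin.natAdd n i)) + (fun i => b (Fin.natAdd n i)) =
      Matrix.vecMul ((fun i => a (Fin.castAdd n i)) + (fun i => b (Fin.castAdd n i))) M
    rw [ha, hb, Matrix.add_vecMul]
  zero_mem' := (Matrix.zero_vecMul M).symm
  smul_mem' c a ha := by
    simp only [Set.mem_ofPred_eq] at ha ⊢
    change c • (fun i => a (Fin.natAdd n i)) = Matrix.vecMul (c • fun i => a (Fin.castAdd n i)) M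
    rw [ha, Matrix.smul_vecMul]

variable {M}

theorem mem_systematicCode {v : Fin (n + n) → ZMod 2} :
    v ∈ systematicCode M ↔ ∃ u, Fin.append u (Matrix.vecMul u M) = v := by
  constructor
  · intro h
    refine ⟨fun i => v (Fin.castAdd n i), ?_⟩
    rw [← show _ = _ from h]
    exact Fin.append_castAdd_natAdd
  · rintro ⟨u, rfl⟩
    change (fun i => _) = _
    simp [-Fin.natAdd_eq_addNat]

theorem isSelfDual_systematicCode (hM : M * M.transpose = 1) : IsSelfDual (systematicCode M) := by
  have hsum (x : Fin (n + n) → ZMod 2) (u : Fin n → ZMod 2) :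
      ∑ i, x i * Fin.append u (Matrix.vecMul u M) i =
        ((fun i => x (Fin.castAdd n i)) +
          Matrix.vecMul (fun i => x (Fin.natAdd n i)) M.transpose) ⬝ᵥ u := by
    rw [add_dotProduct, Matrix.vecMul_transpose, dotProduct_comm (Matrix.mulVec _ _),
      Matrix.dotProduct_mulVec, dotProduct_comm (Matrix.vecMul _ _)]
    simp [Fin.sum_univ_add, dotProduct, -Fin.natAdd_eq_addNat]
  have hadd (u : Fin n → ZMod 2) : u + u = 0 := by
    ext i
    exact CharTwo.add_self_eq_zero _
  intro x
  constructor
  · intro hx y hy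
    obtain ⟨a, rfl⟩ := mem_systematicCode.1 hx
    obtain ⟨b, rfl⟩ := mem_systematicCode.1 hy
    rw [hsum]
    simp [hM, hadd, -Fin.natAdd_eq_addNat]
  · intro h
    have h0 := dotProduct_eq_zero _ fun u => (hsum x u).symm.trans
      (h _ (mem_systematicCode.2 ⟨u, rfl⟩))
    rw [add_eq_zero_iff_eq_neg, ← add_eq_zero_iff_eq_neg.1 (hadd _)] at h0
    change _ = _
    rw [h0, Matrix.vecMul_vecMul, mul_eq_one_comm.1 hM, Matrix.vecMul_one]

theorem hamWt_append (u v : Fin n → ZMod 2) : hamWt (Fin.append u v) = hamWt u + hamWt v := by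
  simp only [hamWt, Finset.card_filter, Fin.sum_univ_add, Fin.append_left, Fin.append_right]

variable (M)

theorem card_systematicCode (w : ℕ) :
    Nat.card {v // v ∈ systematicCode M ∧ hamWt v = w} =
      ∑ p ∈ Finset.HasAntidiagonal.antidiagonal w, weightCount M p.1 p.2 := by
  let S := Finset.univ.filter fun u : Fin n → ZMod 2 =>
    hamWt u + hamWt (Matrix.vecMul u M) = w
  have hcard : Nat.card {v // v ∈ systematicCode M ∧ hamWt v = w} = S.card := by
    rw [← Nat.card_eq_finsetCard]
    refine Nat.card_congr ⟨fun v => ⟨fun i => v.1 (Fin.castAdd n i), ?_⟩,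
      fun u => ⟨Fin.append u.1 (Matrix.vecMul u.1 M), mem_systematicCode.2 ⟨u.1, rfl⟩, ?_⟩,
      fun v => ?_, fun u => ?_⟩
    · obtain ⟨v, hv, rfl⟩ := v
      obtain ⟨u, rfl⟩ := mem_systematicCode.1 hv
      simp [S, hamWt_append]
    · rw [hamWt_append]
      exact (Finset.mem_filter.1 u.2).2
    · obtain ⟨v, hv, rfl⟩ := v
      obtain ⟨u, rfl⟩ := mem_systematicCode.1 hv
      simp
    · simp
  rw [hcard, Finset.card_eq_sum_card_fiberwise (t := Finset.HasAntidiagonal.antidiagonal w)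
    (f := fun u => (hamWt u, hamWt (Matrix.vecMul u M))) fun u hu => by simpa [S] using hu]
  refine Finset.sum_congr rfl fun p hp => ?_
  rw [Finset.HasAntidiagonal.mem_antidiagonal] at hp
  rw [weightCount, Finset.filter_filter]
  congr 1
  ext u
  simp only [Finset.mem_filter, Finset.mem_univ, true_and, Prod.ext_iff]
  constructor
  · exact fun h => h.2
  · exact fun h => ⟨by rw [h.1, h.2, hp], h⟩

end SystematicCode

/-- The rows of the right half of a systematic generator matrix, as binary numbers. -/
def codeRows : List ℕ :=
  [53303099111, 40326317780, 14428006738, 53900930097, 1291818093, 27627041857, 41545230783,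
    44906617951, 15482851654, 17781634802, 2979501420, 28872749256, 4990567637, 45215554325,
    47938950652, 26855633615, 34433348940, 60610013147, 14593897921, 8693363813, 40140675283,
    28293932848, 44327185682, 53288886237, 15394937824, 41806425966, 60682624739, 45609921136,
    54003815351, 47745294282, 572776188, 294000838, 206652977, 47481204, 1025519232, 1073729536]

/-- The columns of the same matrix. -/
def codeCols : List ℕ :=
  [4640911609, 3058860997, 12122191315, 1652804816, 14377185998, 14481376857, 12610166711,
    21300173379, 9460737348, 23616201219, 23201797819, 21203263693, 38480506801, 17354951277,
    40642986062, 44300248543, 40381123956, 38234979898, 45718189721, 34415092573, 48040812349,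
    52951767230, 48161446740, 46155599806, 54274586119, 44466447142, 56525529336, 56548809085,
    54684421508, 52722687715, 13926583, 455093576, 588534086, 762243492, 346196521, 1054040267]

/-- The pairs `(k, j)` with `1 ≤ k ≤ 5` and `k + j < 12`, each with the count `0`. -/
def zeroCounts : List (ℕ × ℕ × ℕ) :=
  (List.range 5).flatMap fun k => (List.range (11 - k)).map fun j => (k + 1, j, 0)

/-- The numbers of sums of `k ≤ 5` rows with weight `12 - k` or `14 - k`. -/
def rowCounts : List (ℕ × ℕ × ℕ) :=
  [(0, 12, 0), (0, 14, 0), (1, 11, 4), (1, 13, 2), (2, 10, 8), (2, 12, 27), (3, 9, 40),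
    (3, 11, 126), (4, 8, 151), (4, 10, 452), (5, 7, 253), (5, 9, 985)]

/-- The numbers of sums of `k ≤ 5` columns with weight `12 - k` or `14 - k`. -/
def colCounts : List (ℕ × ℕ × ℕ) :=
  [(0, 12, 0), (0, 14, 0), (1, 11, 4), (1, 13, 1), (2, 10, 9), (2, 12, 25), (3, 9, 47),
    (3, 11, 124), (4, 8, 139), (4, 10, 432), (5, 7, 252), (5, 9, 1016)]

theorem checkCounts_codeRows_five : checkCounts codeRows 36 5 (zeroCounts ++ rowCounts) = true := by
  decide +kernel

theorem checkCounts_codeCols_five : checkCounts codeCols 36 5 (zeroCounts ++ colCounts) = true := by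
  decide +kernel

theorem checkCounts_codeRows_six :
    checkCounts codeRows 36 6 [(6, 6, 335), (6, 8, 1697)] = true := by
  decide +kernel

theorem checkCounts_codeCols_six : checkCounts codeCols 36 6 [(6, 8, 1719)] = true := by
  decide +kernel

theorem checkCounts_codeRows_seven : checkCounts codeRows 36 7 [(7, 7, 2034)] = true := by
  decide +kernel

/-- The right half of a systematic generator matrix. -/
abbrev codeMatrix : Matrix (Fin 36) (Fin 36) (ZMod 2) := bitMatrix 36 36 codeRows

theorem codeMatrix_mul_transpose : codeMatrix * codeMatrix.transpose = 1 := by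
  have : ∀ i k, ∑ j, codeMatrix i j * codeMatrix k j = if i = k then 1 else 0 := by
    decide +kernel
  ext i k
  rw [Matrix.mul_apply, Matrix.one_apply, ← this]
  rfl

theorem codeMatrix_transpose : codeMatrix.transpose = bitMatrix 36 36 codeCols := by
  have : ∀ i j : Fin 36, (codeRows.getD j 0).testBit i = (codeCols.getD i 0).testBit j := by
    decide +kernel
  ext i j
  simp only [bitMatrix, bitVec, Matrix.transpose_apply, Matrix.of_apply, this i j]

theorem choose_thirtySix_le {k : ℕ} (hk : k ≤ 7) : Nat.choose 36 k ≤ 2 ^ 23 := by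
  interval_cases k <;> decide +kernel

theorem weightCount_codeMatrix {K : ℕ} {T : List (ℕ × ℕ × ℕ)}
    (h : checkCounts codeRows 36 K T = true) {k j c : ℕ} (he : (k, j, c) ∈ T) (hk : k ≤ K)
    (hK : K ≤ 7) : weightCount codeMatrix k j = c :=
  weightCount_of_checkCounts h rfl (by norm_num) he hk (choose_thirtySix_le (hk.trans hK))

theorem weightCount_codeMatrix_swap {K : ℕ} {T : List (ℕ × ℕ × ℕ)}
    (h : checkCounts codeCols 36 K T = true) {k j c : ℕ} (he : (k, j, c) ∈ T) (hk : k ≤ K)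
    (hK : K ≤ 7) : weightCount codeMatrix j k = c := by
  rw [← weightCount_transpose codeMatrix_mul_transpose, codeMatrix_transpose]
  exact weightCount_of_checkCounts h rfl (by norm_num) he hk (choose_thirtySix_le (hk.trans hK))

theorem mem_zeroCounts {k j : ℕ} (hk : 1 ≤ k) (hk5 : k ≤ 5) (hj : k + j < 12) :
    (k, j, 0) ∈ zeroCounts := by
  simp only [zeroCounts, List.mem_flatMap, List.mem_range, List.mem_map, Prod.mk.injEq, and_true]
  exact ⟨k - 1, by lia, j, by lia, by lia, rfl⟩

theorem hamWt_eq_zero {ι R : Type*} [Fintype ι] [Zero R] [DecidableEq R] {v : ι → R} :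
    hamWt v = 0 ↔ v = 0 := by
  simp [hamWt, Finset.filter_eq_empty_iff, funext_iff]

theorem twelve_le_hamWt {v : Fin (36 + 36) → ZMod 2} (hv : v ∈ systematicCode codeMatrix)
    (h0 : v ≠ 0) : 12 ≤ hamWt v := by
  obtain ⟨u, rfl⟩ := mem_systematicCode.1 hv
  have hu : u ≠ 0 := by
    rintro rfl
    refine h0 ?_
    rw [Matrix.zero_vecMul, ← hamWt_eq_zero, hamWt_append, hamWt_eq_zero.2 rfl]
  have hw : Matrix.vecMul u codeMatrix ≠ 0 := fun h => hu <| by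
    rw [← Matrix.vecMul_one u, ← codeMatrix_mul_transpose, ← Matrix.vecMul_vecMul, h,
      Matrix.zero_vecMul]
  rw [hamWt_append]
  by_contra! hlt
  have hu1 := Nat.one_le_iff_ne_zero.2 (mt hamWt_eq_zero.1 hu)
  have hw1 := Nat.one_le_iff_ne_zero.2 (mt hamWt_eq_zero.1 hw)
  have hne : weightCount codeMatrix (hamWt u) (hamWt (Matrix.vecMul u codeMatrix)) ≠ 0 :=
    weightCount_ne_zero codeMatrix u
  rcases le_or_gt (hamWt u) 5 with h | h
  · exact hne (weightCount_codeMatrix checkCounts_codeRows_five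
      (List.mem_append_left _ (mem_zeroCounts hu1 h hlt)) h (by norm_num))
  · exact hne (weightCount_codeMatrix_swap checkCounts_codeCols_five
      (List.mem_append_left _ (mem_zeroCounts hw1 (by lia) (by lia))) (by lia) (by norm_num))

theorem weightCount_rowCounts : ∀ e ∈ rowCounts, weightCount codeMatrix e.1 e.2.1 = e.2.2 :=
  fun e he => weightCount_codeMatrix checkCounts_codeRows_five (List.mem_append_right _ he)
    ((by decide +kernel : ∀ e ∈ rowCounts, e.1 ≤ 5) e he) (by norm_num)

theorem weightCount_colCounts : ∀ e ∈ colCounts, weightCount codeMatrix e.2.1 e.1 = e.2.2 :=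
  fun e he => weightCount_codeMatrix_swap checkCounts_codeCols_five (List.mem_append_right _ he)
    ((by decide +kernel : ∀ e ∈ colCounts, e.1 ≤ 5) e he) (by norm_num)

theorem sum_antidiagonal_twelve {f : ℕ → ℕ → ℕ} (hr : ∀ e ∈ rowCounts, f e.1 e.2.1 = e.2.2)
    (hc : ∀ e ∈ colCounts, f e.2.1 e.1 = e.2.2) (h66 : f 6 6 = 335) :
    ∑ p ∈ Finset.HasAntidiagonal.antidiagonal 12, f p.1 p.2 = 1242 := by
  simp only [rowCounts, colCounts, List.forall_mem_cons] at hr hc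
  simp [Finset.Nat.sum_antidiagonal_eq_sum_range_succ_mk, Finset.sum_range_succ, hr, hc, h66]

theorem sum_antidiagonal_fourteen {f : ℕ → ℕ → ℕ} (hr : ∀ e ∈ rowCounts, f e.1 e.2.1 = e.2.2)
    (hc : ∀ e ∈ colCounts, f e.2.1 e.1 = e.2.2) (h68 : f 6 8 = 1697) (h77 : f 7 7 = 2034)
    (h86 : f 8 6 = 1719) :
    ∑ p ∈ Finset.HasAntidiagonal.antidiagonal 14, f p.1 p.2 = 8640 := by
  simp only [rowCounts, colCounts, List.forall_mem_cons] at hr hc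
  simp [Finset.Nat.sum_antidiagonal_eq_sum_range_succ_mk, Finset.sum_range_succ, hr, hc, h68, h77,
    h86]

theorem card_hamWt_twelve :
    Nat.card {v // v ∈ systematicCode codeMatrix ∧ hamWt v = 12} = 1242 := by
  rw [card_systematicCode]
  exact sum_antidiagonal_twelve weightCount_rowCounts weightCount_colCounts
    (weightCount_codeMatrix checkCounts_codeRows_six (by simp) (by norm_num) (by norm_num))

theorem card_hamWt_fourteen :
    Nat.card {v // v ∈ systematicCode codeMatrix ∧ hamWt v = 14} = 8640 := by
  rw [card_systematicCode]
  exact sum_antidiagonal_fourteen weightCount_rowCounts weightCount_colCounts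
    (weightCount_codeMatrix checkCounts_codeRows_six (by simp) (by norm_num) (by norm_num))
    (weightCount_codeMatrix checkCounts_codeRows_seven (by simp) (by norm_num) (by norm_num))
    (weightCount_codeMatrix_swap checkCounts_codeCols_six (by simp) (by norm_num) (by norm_num))

/-- There is a self-dual binary linear code of length 72 with minimum nonzero Hamming
weight 12, having exactly 1242 codewords of weight 12 and exactly 8640 codewords of
weight 14 (weight enumerator `W_{72,1}` with γ = 0 and β = 621). -/
theorem exists_selfDual_code_72_gamma_0_beta_621 :
    ∃ C : Submodule (ZMod 2) (Fin 72 → ZMod 2),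
      IsSelfDual C ∧
      IsLeast {k | ∃ v ∈ C, v ≠ 0 ∧ hamWt v = k} 12 ∧
      Nat.card {v : Fin 72 → ZMod 2 // v ∈ C ∧ hamWt v = 12} = 1242 ∧
      Nat.card {v : Fin 72 → ZMod 2 // v ∈ C ∧ hamWt v = 14} = 8640 := by
  refine ⟨systematicCode codeMatrix, isSelfDual_systematicCode codeMatrix_mul_transpose,
    ⟨?_, ?_⟩, card_hamWt_twelve, card_hamWt_fourteen⟩
  · have : Nat.card {v // v ∈ systematicCode codeMatrix ∧ hamWt v = 12} ≠ 0 := by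
      rw [card_hamWt_twelve]
      norm_num
    obtain ⟨v, hv, hw⟩ := (Nat.card_ne_zero.1 this).1
    refine ⟨v, hv, ?_, hw⟩
    rintro rfl
    simp [hamWt] at hw
  · rintro _ ⟨v, hv, h0, rfl⟩
    exact twelve_le_hamWt hv h0
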